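/- arXiv:1102.2442 — 10 statements merged into one kernel-verified Lean document; each statement's English description precedes it below -/
import Mathlib

section
/- Let b ≥ 2 be an integer. Every proper normal subgroup N of the binary dihedral group D*_{4b} is either cyclic, or b is even and N is a binary dihedral group of index 2, i.e. N is isomorphic to D*_{4·(b/2)}. -/
namespace QuaternionGroup

theorem a_one_zpow {n : ℕ} (k : ℤ) : (a 1 : QuaternionGroup n) ^ k = a k := by
  cases k with
  | ofNat k => simp
  | negSucc k =>
    rw [zpow_negSucc, inv_eq_iff_mul_eq_one, a_one_pow, a_mul_a, one_def]
    congr 1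
    push_cast
    ring

theorem a_intCast_mul_mem {n : ℕ} {N : Subgroup (QuaternionGroup n)} {i : ZMod (2 * n)}
    (h : a i ∈ N) (k : ℤ) : a ((k : ZMod (2 * n)) * i) ∈ N := by
  obtain ⟨j, rfl⟩ := ZMod.intCast_surjective i
  have := N.zpow_mem h k
  rwa [← a_one_zpow, ← zpow_mul, a_one_zpow, mul_comm j k, Int.cast_mul] at this

theorem eq_top_of_a_one_mem_of_xa_mem {n : ℕ} {N : Subgroup (QuaternionGroup n)}
    (h : a 1 ∈ N) {i : ZMod (2 * n)} (hi : xa i ∈ N) : N = ⊤ := by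
  have ha (j : ZMod (2 * n)) : a j ∈ N := by
    obtain ⟨k, rfl⟩ := ZMod.intCast_surjective j
    simpa using a_intCast_mul_mem h k
  rw [Subgroup.eq_top_iff']
  rintro (j | j)
  · exact ha j
  · simpa using N.mul_mem hi (ha (j - i))

theorem a_two_mem_of_xa_mem {n : ℕ} {N : Subgroup (QuaternionGroup n)} (hN : N.Normal)
    {i : ZMod (2 * n)} (hi : xa i ∈ N) : a 2 ∈ N := by
  have h := N.mul_mem (N.inv_mem hi) (hN.conj_mem _ hi (a (-1)))
  have e : (a (-1) : QuaternionGroup n)⁻¹ = a 1 := congrArg a (neg_neg 1)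
  have e' : (xa i)⁻¹ = xa ((n : ZMod (2 * n)) + i) := rfl
  rw [e, e', a_mul_xa, xa_mul_a, xa_mul_xa] at h
  convert h using 2
  ring

theorem isCyclic_of_forall_xa_notMem {n : ℕ} {N : Subgroup (QuaternionGroup n)}
    (h : ∀ i, xa i ∉ N) : IsCyclic N := by
  have hle : N ≤ Subgroup.zpowers (a 1) := by
    rintro (j | j) hj
    · obtain ⟨k, rfl⟩ := ZMod.intCast_surjective j
      exact ⟨k, a_one_zpow k⟩
    · exact absurd hj (h j)
  exact isCyclic_of_injective (Subgroup.inclusion hle) (Subgroup.inclusion_injective hle)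

/-- Multiplication by two, as a homomorphism from `ZMod n` to `ZMod (2 * n)`. -/
def zmodDouble (n : ℕ) : ZMod n →+ ZMod (2 * n) :=
  ZMod.lift n ⟨(AddMonoidHom.mulLeft 2).comp (Int.castAddHom _), by
    change (2 * ((n : ℤ) : ZMod (2 * n))) = 0
    exact_mod_cast ZMod.natCast_self (2 * n)⟩

theorem zmodDouble_intCast (n : ℕ) (k : ℤ) : zmodDouble n k = 2 * k := by
  simp [zmodDouble]

theorem zmodDouble_natCast (n k : ℕ) : zmodDouble n k = 2 * k := by
  exact_mod_cast zmodDouble_intCast n k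

theorem zmodDouble_injective (n : ℕ) : Function.Injective (zmodDouble n) := by
  rw [injective_iff_map_eq_zero]
  intro x hx
  obtain ⟨k, rfl⟩ := ZMod.intCast_surjective x
  rw [zmodDouble_intCast] at hx
  have hx' : ((2 * k : ℤ) : ZMod (2 * n)) = 0 := by exact_mod_cast hx
  rw [ZMod.intCast_zmod_eq_zero_iff_dvd] at hx'
  rw [ZMod.intCast_zmod_eq_zero_iff_dvd]
  push_cast at hx'
  exact (mul_dvd_mul_iff_left two_ne_zero).mp hx'

/-- The embedding of `QuaternionGroup m` in `QuaternionGroup (2 * m)` as the subgroup generated by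
`a 2` and `xa i`. -/
def doubleHom (m : ℕ) (i : ZMod (2 * (2 * m))) :
    QuaternionGroup m →* QuaternionGroup (2 * m) where
  toFun
    | a j => a (zmodDouble (2 * m) j)
    | xa j => xa (i + zmodDouble (2 * m) j)
  map_one' := congrArg a (map_zero _)
  map_mul' := by
    rintro (j | j) (k | k)
    · simp
    · simp [add_sub_assoc]
    · simp [add_assoc]
    · simp only [xa_mul_xa, map_add, map_sub, zmodDouble_natCast]
      congr 1
      push_cast
      ring

theorem doubleHom_injective (m : ℕ) (i : ZMod (2 * (2 * m))) :
    Function.Injective (doubleHom m i) := by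
  rintro (j | j) (k | k) h
  · exact congrArg a (zmodDouble_injective _ (a.inj h))
  · cases h
  · cases h
  · exact congrArg xa (zmodDouble_injective _ (add_left_cancel (xa.inj h)))

theorem range_doubleHom_eq {m : ℕ} {N : Subgroup (QuaternionGroup (2 * m))} (hN : N.Normal)
    (h1 : a 1 ∉ N) {i : ZMod (2 * (2 * m))} (hi : xa i ∈ N) :
    (doubleHom m i).range = N := by
  have h2 := a_two_mem_of_xa_mem hN hi
  have hd (j : ZMod (2 * m)) : a (zmodDouble (2 * m) j) ∈ N := by
    obtain ⟨k, rfl⟩ := ZMod.intCast_surjective j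
    rw [zmodDouble_intCast, mul_comm (2 : ZMod (2 * (2 * m)))]
    exact a_intCast_mul_mem h2 k
  have hr (j : ZMod (2 * (2 * m))) (hj : a j ∈ N) : ∃ k, zmodDouble (2 * m) k = j := by
    obtain ⟨k, rfl⟩ := ZMod.intCast_surjective j
    obtain ⟨l, rfl | rfl⟩ := Int.even_or_odd' k
    · exact ⟨l, by rw [zmodDouble_intCast]; push_cast; rfl⟩
    · refine absurd ?_ h1
      have := N.mul_mem (hd (-l : ℤ)) hj
      rw [zmodDouble_intCast, a_mul_a] at this
      convert this using 2
      push_cast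
      ring
  apply le_antisymm
  · rintro _ ⟨j | j, rfl⟩
    · exact hd j
    · exact N.mul_mem hi (hd j)
  · rintro (j | j) hj
    · obtain ⟨k, hk⟩ := hr j hj
      exact ⟨a k, congrArg a hk⟩
    · have h := N.mul_mem (N.inv_mem hi) hj
      have e : (xa i)⁻¹ * xa j = a (j - i) := by
        rw [inv_mul_eq_iff_eq_mul, xa_mul_a, add_sub_cancel]
      rw [e] at h
      obtain ⟨k, hk⟩ := hr _ h
      exact ⟨xa k, congrArg xa (by rw [hk, add_sub_cancel])⟩

theorem even_of_a_one_notMem {n : ℕ} {N : Subgroup (QuaternionGroup n)} (hN : N.Normal)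
    (h1 : a 1 ∉ N) {i : ZMod (2 * n)} (hi : xa i ∈ N) : Even n := by
  by_contra hn
  obtain ⟨m, hm⟩ := Nat.not_even_iff_odd.mp hn
  apply h1
  have hsq := N.pow_mem hi 2
  rw [xa_sq] at hsq
  have := N.mul_mem (a_intCast_mul_mem (a_two_mem_of_xa_mem hN hi) (-m)) hsq
  rw [a_mul_a] at this
  have e : (n : ZMod (2 * n)) = 2 * m + 1 := by
    exact_mod_cast congrArg (Nat.cast : ℕ → ZMod (2 * n)) hm
  rw [e] at this
  convert this using 2
  push_cast
  ring

end QuaternionGroup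

open QuaternionGroup in
/-- Every proper normal subgroup of the binary dihedral group
`D*_{4b} = QuaternionGroup b` (for `b ≥ 2`) is either cyclic, or `b` is even and
the subgroup is a binary dihedral group of index 2, i.e. isomorphic to
`D*_{4·(b/2)} = QuaternionGroup (b / 2)`. -/
theorem stmt_0 (b : ℕ) (hb : 2 ≤ b) (N : Subgroup (QuaternionGroup b))
    (hN : N.Normal) (hproper : N ≠ ⊤) :
    IsCyclic N ∨
      (Even b ∧ N.index = 2 ∧ Nonempty (N ≃* QuaternionGroup (b / 2))) := by
  by_cases h : ∀ i, xa i ∉ N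
  · exact .inl (isCyclic_of_forall_xa_notMem h)
  right
  push Not at h
  obtain ⟨i, hi⟩ := h
  have h1 : a 1 ∉ N := fun h1 => hproper (eq_top_of_a_one_mem_of_xa_mem h1 hi)
  have hbe := even_of_a_one_notMem hN h1 hi
  refine ⟨hbe, ?_⟩
  obtain ⟨m, rfl⟩ := even_iff_two_dvd.mp hbe
  have : NeZero m := ⟨by lia⟩
  let e : N ≃* QuaternionGroup m :=
    ((MonoidHom.ofInjective (doubleHom_injective m i)).trans
      (MulEquiv.subgroupCongr (range_doubleHom_eq hN h1 hi))).symm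
  have hdiv (k : ℕ) (hk : k = m) : Nonempty (N ≃* QuaternionGroup k) := by
    subst hk
    exact ⟨e⟩
  refine ⟨?_, hdiv _ (Nat.mul_div_cancel_left m two_pos)⟩
  have hc := N.card_mul_index
  rw [Nat.card_congr e.toEquiv, Nat.card_eq_fintype_card, Nat.card_eq_fintype_card, card, card] at hc
  have hm : 0 < 4 * m := by have := NeZero.pos m; lia
  apply Nat.eq_of_mul_eq_mul_left hm
  rw [hc]
  ring
end

section
/- Every nontrivial proper normal subgroup of the binary tetrahedral group T* is isomorphic either to ℤ/2 or to the binary dihedral group D*_8 (the quaternion group of order 8). -/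
open Matrix

/-- The inclusion of the quaternion group of order 8 as the Sylow 2-subgroup of `SL(2, ℤ/3)`. -/
def quaternionToSL : QuaternionGroup 2 →* SpecialLinearGroup (Fin 2) (ZMod 3) where
  toFun
    | .a i => ⟨!![0, -1; 1, 0], by decide⟩ ^ i.val
    | .xa i => ⟨!![1, 1; 1, -1], by decide⟩ * ⟨!![0, -1; 1, 0], by decide⟩ ^ i.val
  map_one' := by decide +kernel
  map_mul' := by decide +kernel

lemma quaternionToSL_injective : Function.Injective quaternionToSL := by
  decide +kernel

lemma exists_quaternionToSL_eq :
    ∀ g : SpecialLinearGroup (Fin 2) (ZMod 3), g ^ 4 = 1 → ∃ q, quaternionToSL q = g := by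
  decide +kernel

lemma quaternionToSL_pow_four : ∀ q, quaternionToSL q ^ 4 = 1 := by
  decide +kernel

lemma sq_eq_neg_one_of_pow_four_eq_one :
    ∀ g : SpecialLinearGroup (Fin 2) (ZMod 3), g ^ 4 = 1 → g = 1 ∨ g = -1 ∨ g ^ 2 = -1 := by
  decide +kernel

lemma isConj_of_sq_eq_neg_one :
    ∀ g : SpecialLinearGroup (Fin 2) (ZMod 3), g ^ 2 = -1 →
      ∀ k : SpecialLinearGroup (Fin 2) (ZMod 3), k ^ 2 = -1 → ∃ h, h * g * h⁻¹ = k := by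
  decide +kernel

lemma exists_commutator_sq_eq_neg_one :
    ∀ g : SpecialLinearGroup (Fin 2) (ZMod 3), g ^ 4 ≠ 1 →
      ∃ h, (g * (h * g⁻¹ * h⁻¹)) ^ 2 = -1 := by
  decide +kernel

lemma exists_mul_pow_pow_four_eq_one :
    ∀ g : SpecialLinearGroup (Fin 2) (ZMod 3), g ^ 4 ≠ 1 →
      ∀ x : SpecialLinearGroup (Fin 2) (ZMod 3), ∃ k : Fin 3, (x * g ^ k.val) ^ 4 = 1 := by
  decide +kernel

lemma mem_of_pow_four_eq_one {N : Subgroup (SpecialLinearGroup (Fin 2) (ZMod 3))}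
    (hN : N.Normal) {g : SpecialLinearGroup (Fin 2) (ZMod 3)} (hg : g ∈ N) (hg2 : g ^ 2 = -1)
    {k : SpecialLinearGroup (Fin 2) (ZMod 3)} (hk : k ^ 4 = 1) : k ∈ N := by
  rcases sq_eq_neg_one_of_pow_four_eq_one k hk with rfl | rfl | hk2
  · exact N.one_mem
  · exact hg2 ▸ N.pow_mem hg 2
  · obtain ⟨h, rfl⟩ := isConj_of_sq_eq_neg_one g hg2 k hk2
    exact hN.conj_mem g hg h

lemma eq_top_of_pow_four_ne_one {N : Subgroup (SpecialLinearGroup (Fin 2) (ZMod 3))}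
    (hN : N.Normal) {g : SpecialLinearGroup (Fin 2) (ZMod 3)} (hg : g ∈ N) (hg4 : g ^ 4 ≠ 1) :
    N = ⊤ := by
  obtain ⟨h, hh⟩ := exists_commutator_sq_eq_neg_one g hg4
  have hc := N.mul_mem hg (hN.conj_mem _ (N.inv_mem hg) h)
  refine (Subgroup.eq_top_iff' N).2 fun x => ?_
  obtain ⟨k, hk⟩ := exists_mul_pow_pow_four_eq_one g hg4 x
  exact (N.mul_mem_cancel_right (N.pow_mem hg k)).1 (mem_of_pow_four_eq_one hN hc hh hk)

/-- Every nontrivial proper normal subgroup of the binary tetrahedral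
group `T* = SL(2, ℤ/3)` is isomorphic either to `ℤ/2` or to the binary dihedral
group `D*_8 = QuaternionGroup 2` (the quaternion group of order 8). -/
theorem stmt_1 (N : Subgroup (Matrix.SpecialLinearGroup (Fin 2) (ZMod 3)))
    (hN : N.Normal) (hbot : N ≠ ⊥) (htop : N ≠ ⊤) :
    Nonempty (N ≃* Multiplicative (ZMod 2)) ∨ Nonempty (N ≃* QuaternionGroup 2) := by
  have h4 : ∀ g ∈ N, g ^ 4 = 1 := fun g hg => by
    by_contra hg4
    exact htop (eq_top_of_pow_four_ne_one hN hg hg4)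
  by_cases hex : ∃ g ∈ N, g ^ 2 = -1
  · obtain ⟨g, hg, hg2⟩ := hex
    have hrange : N = quaternionToSL.range := by
      ext k
      refine ⟨fun hk => exists_quaternionToSL_eq k (h4 k hk), ?_⟩
      rintro ⟨q, rfl⟩
      exact mem_of_pow_four_eq_one hN hg hg2 (quaternionToSL_pow_four q)
    subst hrange
    exact .inr ⟨(MonoidHom.ofInjective quaternionToSL_injective).symm⟩
  · push Not at hex
    have hpm : ∀ g ∈ N, g = 1 ∨ g = -1 := fun g hg =>
      (sq_eq_neg_one_of_pow_four_eq_one g (h4 g hg)).imp_right (Or.resolve_right · (hex g hg))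
    obtain ⟨g, hg, hg1⟩ := N.bot_or_exists_ne_one.resolve_left hbot
    obtain rfl := (hpm g hg).resolve_left hg1
    have hzpowers : N = Subgroup.zpowers (-1) := by
      refine le_antisymm (fun k hk => ?_) (Subgroup.zpowers_le.2 hg)
      rcases hpm k hk with rfl | rfl
      · exact one_mem _
      · exact Subgroup.mem_zpowers _
    have hcard : Nat.card N = 2 := by
      rw [hzpowers, Nat.card_zpowers]
      exact orderOf_eq_prime neg_one_sq hg1
    exact .inl ⟨mulEquivOfPrimeCardEq (p := 2) hcard (by simp)⟩
end

section
/- Let b ≥ 2 be an integer, let A be an abelian group (e.g. A = ℤ/m), and let G be a group containing at most one element of order 2 (as holds for every 3-dimensional spherical space form group). If there is an injective group homomorphism from the binary dihedral group D*_{4b} into A × G, then there is an injective group homomorphism from D*_{4b} into G; moreover, if the image of the original homomorphism is a normal subgroup of A × G, then D*_{4b} embeds into G with normal image. -/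
/-- The kernel of the second component of an embedding into `A × G`, with `A` abelian, is
central. -/
theorem MonoidHom.commute_of_prod_injective {Q A G : Type*} [Group Q] [CommGroup A] [Group G]
    {φ : Q →* A × G} (hφ : Function.Injective φ) {k : Q} (hk : (φ k).2 = 1) (g : Q) :
    Commute k g :=
  hφ <| Prod.ext (by simp [mul_comm]) (by simp [hk])

namespace QuaternionGroup

variable {n : ℕ}

theorem two_ne_zero_of_two_le (hn : 2 ≤ n) : (2 : ZMod (2 * n)) ≠ 0 := fun h => by
  have h2 : ((2 : ℕ) : ZMod (2 * n)) = 0 := by exact_mod_cast h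
  have := Nat.le_of_dvd two_pos ((ZMod.natCast_eq_zero_iff 2 (2 * n)).1 h2)
  omega

theorem not_commute_xa_a_one (hn : 2 ≤ n) (i : ZMod (2 * n)) : ¬ Commute (xa i) (a 1) := by
  intro h
  have h1 : i + 1 = i - 1 := xa.inj h
  exact two_ne_zero_of_two_le hn (by linear_combination h1)

theorem two_mul_eq_zero_of_commute {i : ZMod (2 * n)} (h : Commute (a i) (xa 0)) :
    2 * i = 0 := by
  have h1 : 0 - i = 0 + i := xa.inj h
  linear_combination -h1

theorem eq_zero_or_eq_natCast_of_two_mul_eq_zero [NeZero n] {i : ZMod (2 * n)}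
    (h : 2 * i = 0) : i = 0 ∨ i = n := by
  obtain ⟨m, hm, rfl⟩ : ∃ m < 2 * n, (m : ZMod (2 * n)) = i :=
    ⟨i.val, ZMod.val_lt i, ZMod.natCast_zmod_val i⟩
  have h2 : ((2 * m : ℕ) : ZMod (2 * n)) = 0 := by exact_mod_cast h
  obtain ⟨c, rfl⟩ := Nat.dvd_of_mul_dvd_mul_left two_pos ((ZMod.natCast_eq_zero_iff _ _).1 h2)
  have hc : c < 2 := by
    by_contra! hc
    nlinarith
  interval_cases c <;> simp

/-- If `A` is abelian and `G` has at most one involution, then the second component of an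
embedding of a generalized quaternion group into `A × G` is injective. -/
theorem snd_comp_injective {A G : Type*} [CommGroup A] [Group G] (hn : 2 ≤ n)
    (hG : ∀ g h : G, orderOf g = 2 → orderOf h = 2 → g = h)
    {φ : QuaternionGroup n →* A × G} (hφ : Function.Injective φ) :
    Function.Injective ((MonoidHom.snd A G).comp φ) := by
  have : NeZero n := ⟨by omega⟩
  set ψ := (MonoidHom.snd A G).comp φ
  have hcomm {k} (hk : ψ k = 1) (g) : Commute k g := MonoidHom.commute_of_prod_injective hφ hk g
  have hxa (i) : ψ (xa i) ≠ 1 := fun hi => not_commute_xa_a_one hn i (hcomm hi _)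
  rw [injective_iff_map_eq_one]
  rintro (i | i) hi
  · rcases eq_zero_or_eq_natCast_of_two_mul_eq_zero
      (two_mul_eq_zero_of_commute (hcomm hi _)) with rfl | rfl
    · rfl
    have hord (j) : orderOf (ψ (xa j)) = 2 :=
      orderOf_eq_prime (by rw [← map_pow, xa_sq, hi]) (hxa j)
    have hker : ψ (a (n + 1)) = 1 := by
      calc ψ (a (n + 1)) = ψ (xa 0) * ψ (xa 1) := by rw [← map_mul, xa_mul_xa, sub_zero]
        _ = ψ (xa 0) ^ 2 := by rw [hG _ _ (hord 1) (hord 0), sq]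
        _ = 1 := by rw [← map_pow, xa_sq, hi]
    have h1 := two_mul_eq_zero_of_commute (hcomm hker _)
    have h2 := two_mul_eq_zero_of_commute (hcomm hi _)
    exact absurd (by linear_combination h1 - h2) (two_ne_zero_of_two_le hn)
  · exact absurd hi (hxa i)

end QuaternionGroup

/-- Let `b ≥ 2`, let `A` be an abelian group, and let `G` be a group with
at most one element of order 2. If the binary dihedral group `D*_{4b} = QuaternionGroup b`
embeds in `A × G`, then it embeds in `G`; moreover, if the image of the original embedding
is normal in `A × G`, then `D*_{4b}` embeds in `G` with normal image. -/
theorem stmt_3 (b : ℕ) (hb : 2 ≤ b) (A G : Type*) [CommGroup A] [Group G]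
    (hG : ∀ g h : G, orderOf g = 2 → orderOf h = 2 → g = h)
    (φ : QuaternionGroup b →* A × G) (hφ : Function.Injective φ) :
    (∃ ψ : QuaternionGroup b →* G, Function.Injective ψ) ∧
      (φ.range.Normal →
        ∃ ψ : QuaternionGroup b →* G, Function.Injective ψ ∧ ψ.range.Normal) := by
  have hψ := QuaternionGroup.snd_comp_injective hb hG hφ
  refine ⟨⟨_, hψ⟩, fun hnormal => ⟨_, hψ, ?_⟩⟩
  rw [MonoidHom.range_comp]
  exact hnormal.map _ Prod.snd_surjective
end

section
/- Let A be an abelian group (e.g. A = ℤ/m), and let G be a group containing at most one element of order 2 (as holds for every 3-dimensional spherical space form group). If there is an injective group homomorphism from the binary tetrahedral group T* = SL(2, ℤ/3) into A × G, then there is an injective group homomorphism from T* into G; moreover, if the image of the original homomorphism is a normal subgroup of A × G, then T* embeds into G with normal image. -/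
open Matrix in
/-- Every central element of `SL(2, ℤ/3)` is a commutator. -/
theorem Matrix.SpecialLinearGroup.exists_commutatorElement_eq_of_forall_commute
    (x : SpecialLinearGroup (Fin 2) (ZMod 3)) (hx : ∀ g, x * g = g * x) :
    ∃ a b : SpecialLinearGroup (Fin 2) (ZMod 3), x = a * b * a⁻¹ * b⁻¹ := by
  have key : x = 1 ∨ x = -1 := by
    have hu : x.1 * !![1, 1; 0, 1] = !![1, 1; 0, 1] * x.1 :=
      congrArg Subtype.val (hx ⟨!![1, 1; 0, 1], by decide⟩)
    have hl : x.1 * !![1, 0; 1, 1] = !![1, 0; 1, 1] * x.1 :=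
      congrArg Subtype.val (hx ⟨!![1, 0; 1, 1], by decide⟩)
    have hdet : x.1.det = 1 := x.2
    suffices h : x.1 = 1 ∨ x.1 = -1 from h.imp Subtype.ext Subtype.ext
    obtain ⟨a, b, c, d, hm⟩ : ∃ a b c d, x.1 = !![a, b; c, d] :=
      ⟨_, _, _, _, Matrix.eta_fin_two x.1⟩
    rw [hm] at hu hl hdet ⊢
    clear hm hx x
    revert a b c d
    decide
  rcases key with rfl | rfl
  · exact ⟨1, 1, by simp⟩
  · exact ⟨⟨!![0, 1; -1, 0], by decide⟩, ⟨!![1, 1; 1, -1], by decide⟩, by decide⟩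

/-- If every central element of `H` is a commutator, an embedding of `H` into the product of an
abelian group and `G` stays injective after projecting to `G`. -/
theorem MonoidHom.injective_snd_comp_of_central_commutators {H A G : Type*} [Group H]
    [CommGroup A] [Group G]
    (hH : ∀ x : H, (∀ g, x * g = g * x) → ∃ a b : H, x = a * b * a⁻¹ * b⁻¹)
    (φ : H →* A × G) (hφ : Function.Injective φ) :
    Function.Injective ((MonoidHom.snd A G).comp φ) := by
  rw [injective_iff_map_eq_one]
  intro x hx
  have hx2 : (φ x).2 = 1 := hx
  have hcentral : ∀ g, x * g = g * x := fun g => hφ <| by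
    ext
    · simp [mul_comm]
    · simp [hx2]
  obtain ⟨a, b, rfl⟩ := hH x hcentral
  apply hφ
  ext
  · simp
  · simpa using hx2


/-- Let `A` be an abelian group and `G` a group with at most one element of
order 2. If the binary tetrahedral group `T* = SL(2, ℤ/3)` embeds in `A × G`, then it
embeds in `G`; moreover, if the image of the original embedding is normal in `A × G`,
then `T*` embeds in `G` with normal image. -/
theorem stmt_4 (A G : Type*) [CommGroup A] [Group G]
    (hG : ∀ g h : G, orderOf g = 2 → orderOf h = 2 → g = h)
    (φ : Matrix.SpecialLinearGroup (Fin 2) (ZMod 3) →* A × G)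
    (hφ : Function.Injective φ) :
    (∃ ψ : Matrix.SpecialLinearGroup (Fin 2) (ZMod 3) →* G, Function.Injective ψ) ∧
      (φ.range.Normal →
        ∃ ψ : Matrix.SpecialLinearGroup (Fin 2) (ZMod 3) →* G,
          Function.Injective ψ ∧ ψ.range.Normal) := by
  have hψ := MonoidHom.injective_snd_comp_of_central_commutators
    Matrix.SpecialLinearGroup.exists_commutatorElement_eq_of_forall_commute φ hφ
  refine ⟨⟨_, hψ⟩, fun hN => ⟨_, hψ, ?_⟩⟩
  rw [MonoidHom.range_comp]
  exact hN.map _ Prod.snd_surjective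
end

section
/- Let A be an abelian group (e.g. A = ℤ/m), and let G be a group containing at most one element of order 2 (as holds for every 3-dimensional spherical space form group). If there is an injective group homomorphism from the binary icosahedral group I* = SL(2, ℤ/5) into A × G, then there is an injective group homomorphism from I* into G; moreover, if the image of the original homomorphism is a normal subgroup of A × G, then I* embeds into G with normal image. -/
namespace Matrix.SpecialLinearGroup

variable {F : Type*} [Field F]

/-- The upper unitriangular element of `SL(2, F)` with off-diagonal entry `x`. -/
def upperUnipotent (x : F) : SpecialLinearGroup (Fin 2) F :=
  ⟨!![1, x; 0, 1], by simp [det_fin_two_of]⟩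

@[simp]
theorem coe_upperUnipotent (x : F) :
    (upperUnipotent x : Matrix (Fin 2) (Fin 2) F) = !![1, x; 0, 1] := rfl

/-- The lower unitriangular element of `SL(2, F)` with off-diagonal entry `x`. -/
def lowerUnipotent (x : F) : SpecialLinearGroup (Fin 2) F :=
  ⟨!![1, 0; x, 1], by simp [det_fin_two_of]⟩

@[simp]
theorem coe_lowerUnipotent (x : F) :
    (lowerUnipotent x : Matrix (Fin 2) (Fin 2) F) = !![1, 0; x, 1] := rfl

/-- The diagonal element of `SL(2, F)` with entries `u` and `u⁻¹`. -/
def diagonalUnit (u : Fˣ) : SpecialLinearGroup (Fin 2) F :=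
  ⟨!![(u : F), 0; 0, ((u⁻¹ : Fˣ) : F)], by simp [det_fin_two_of]⟩

@[simp]
theorem coe_diagonalUnit (u : Fˣ) :
    (diagonalUnit u : Matrix (Fin 2) (Fin 2) F) = !![(u : F), 0; 0, ((u⁻¹ : Fˣ) : F)] := rfl

theorem diagonalUnit_mul_upperUnipotent (u : Fˣ) (x : F) :
    diagonalUnit u * upperUnipotent x =
      upperUnipotent ((u ^ 2 - 1) * x) * upperUnipotent x * diagonalUnit u := by
  ext i j
  have hu : (u : F) ≠ 0 := u.ne_zero
  fin_cases i <;> fin_cases j <;>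
    simp [Matrix.mul_apply, Fin.sum_univ_two]
  field_simp
  ring

theorem lowerUnipotent_mul_diagonalUnit (u : Fˣ) (x : F) :
    lowerUnipotent x * diagonalUnit u =
      diagonalUnit u * lowerUnipotent ((u ^ 2 - 1) * x) * lowerUnipotent x := by
  ext i j
  have hu : (u : F) ≠ 0 := u.ne_zero
  fin_cases i <;> fin_cases j <;>
    simp [Matrix.mul_apply, Fin.sum_univ_two]
  field_simp
  ring

theorem eq_upper_mul_lower_mul_upper (M : SpecialLinearGroup (Fin 2) F) (h : M 1 0 ≠ 0) :
    M = upperUnipotent ((M 0 0 - 1) / M 1 0) * lowerUnipotent (M 1 0) *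
      upperUnipotent ((M 1 1 - 1) / M 1 0) := by
  have hdet := M.det_coe
  rw [det_fin_two] at hdet
  ext i j
  fin_cases i <;> fin_cases j <;>
    simp [Matrix.mul_apply, Fin.sum_univ_two, h]
  · field_simp
    linear_combination -hdet
  · field_simp
    ring

/-- If some unit of `F` has square different from `1`, then `SL(2, F)` is perfect: it has no
nontrivial homomorphism to a commutative group. -/
theorem hom_commGroup_eq_one {A : Type*} [CommGroup A] (u : Fˣ) (hu : (u : F) ^ 2 - 1 ≠ 0)
    (f : SpecialLinearGroup (Fin 2) F →* A) : f = 1 := by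
  have hU (x : F) : f (upperUnipotent x) = 1 := by
    have h := congrArg f (diagonalUnit_mul_upperUnipotent u (x / ((u : F) ^ 2 - 1)))
    rw [mul_div_cancel₀ _ hu] at h
    simpa [mul_comm, mul_assoc, mul_left_comm] using h
  have hL (x : F) : f (lowerUnipotent x) = 1 := by
    have h := congrArg f (lowerUnipotent_mul_diagonalUnit u (x / ((u : F) ^ 2 - 1)))
    rw [mul_div_cancel₀ _ hu] at h
    simpa [mul_comm, mul_assoc, mul_left_comm] using h
  have key (M : SpecialLinearGroup (Fin 2) F) (h : M 1 0 ≠ 0) : f M = 1 := by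
    rw [eq_upper_mul_lower_mul_upper M h]
    simp [hU, hL]
  ext M
  by_cases h : M 1 0 = 0
  · have hdet := M.det_coe
    rw [det_fin_two, h] at hdet
    have hne : (M * lowerUnipotent 1 : SpecialLinearGroup (Fin 2) F) 1 0 ≠ 0 := by
      have : M 1 1 ≠ 0 := by
        intro h0
        simp [h0] at hdet
      simpa [Matrix.mul_apply, Fin.sum_univ_two, h] using this
    simpa [hL] using key _ hne
  · exact key M h

end Matrix.SpecialLinearGroup

/-- STATEMENT 4: Let `A` be an abelian group and `G` a group with at most one element of
order 2. If the binary icosahedral group `I* = SL(2, ℤ/5)` embeds in `A × G`, then it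
embeds in `G`; moreover, if the image of the original embedding is normal in `A × G`,
then `I*` embeds in `G` with normal image. -/
theorem stmt_5 (A G : Type*) [CommGroup A] [Group G]
    (hG : ∀ g h : G, orderOf g = 2 → orderOf h = 2 → g = h)
    (φ : Matrix.SpecialLinearGroup (Fin 2) (ZMod 5) →* A × G)
    (hφ : Function.Injective φ) :
    (∃ ψ : Matrix.SpecialLinearGroup (Fin 2) (ZMod 5) →* G, Function.Injective ψ) ∧
      (φ.range.Normal →
        ∃ ψ : Matrix.SpecialLinearGroup (Fin 2) (ZMod 5) →* G,
          Function.Injective ψ ∧ ψ.range.Normal) := by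
  have h2 : (2 : ZMod 5) ≠ 0 := by decide
  have h3 : (2 : ZMod 5) ^ 2 - 1 ≠ 0 := by decide
  have : Fact (Nat.Prime 5) := ⟨by norm_num⟩
  have hfst : (MonoidHom.fst A G).comp φ = 1 :=
    Matrix.SpecialLinearGroup.hom_commGroup_eq_one (Units.mk0 (2 : ZMod 5) h2) h3 _
  have hinj : Function.Injective ((MonoidHom.snd A G).comp φ) := by
    intro x y hxy
    exact hφ (Prod.ext ((DFunLike.congr_fun hfst x).trans (DFunLike.congr_fun hfst y).symm) hxy)
  refine ⟨⟨_, hinj⟩, fun hN => ⟨_, hinj, ?_⟩⟩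
  rw [MonoidHom.range_comp]
  exact hN.map _ Prod.snd_surjective
end

section
/- Let k ≥ 1 be an integer and p ≥ 3 an odd integer. The group D'_{2^{k+2}p} contains no binary dihedral subgroups: for every b ≥ 2 there is no injective group homomorphism from the binary dihedral group D*_{4b} into D'_{2^{k+2}p}. -/
/-- Relators for the group `D'_{2^{k+2} p} = ⟨x, y ∣ x^(2^(k+2)) = y^p = 1, y x = x y⁻¹⟩`,
with generator `0` playing the role of `x` and generator `1` the role of `y`.
The relation `y x = x y⁻¹` is encoded by the relator `y * x * y * x⁻¹ = (y x) (x y⁻¹)⁻¹`. -/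
def dPrimeRels (k p : ℕ) : Set (FreeGroup (Fin 2)) :=
  {FreeGroup.of 0 ^ 2 ^ (k + 2), FreeGroup.of 1 ^ p,
   FreeGroup.of 1 * FreeGroup.of 0 * FreeGroup.of 1 * (FreeGroup.of 0)⁻¹}

/-- The group `D'_{2^{k+2} p}`, presented as
`⟨x, y ∣ x^(2^(k+2)) = y^p = 1, y x = x y⁻¹⟩`. -/
abbrev DPrime (k p : ℕ) : Type := PresentedGroup (dPrimeRels k p)

namespace DPrime

variable {k p : ℕ}

/-- The generator `x` of `D'_{2^{k+2} p}`. -/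
abbrev x (k p : ℕ) : DPrime k p := PresentedGroup.of 0

/-- The generator `y` of `D'_{2^{k+2} p}`. -/
abbrev y (k p : ℕ) : DPrime k p := PresentedGroup.of 1

theorem semiconjBy_x : SemiconjBy (x k p) (y k p)⁻¹ (y k p) := by
  have h : y k p * x k p * y k p * (x k p)⁻¹ = 1 :=
    PresentedGroup.one_of_mem (rels := dPrimeRels k p) (by simp [dPrimeRels])
  rw [SemiconjBy, ← mul_inv_eq_one, ← inv_eq_one]
  simpa [mul_assoc] using h

/-- Every element has the normal form `x ^ i * y ^ j`. -/
theorem exists_eq_zpow_mul_zpow (g : DPrime k p) :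
    ∃ i j : ℤ, g = x k p ^ i * y k p ^ j := by
  have hg : g ∈ Subgroup.closure (Set.range (PresentedGroup.of (rels := dPrimeRels k p))) := by
    simp
  have hyx (j : ℤ) : y k p ^ j * x k p = x k p * y k p ^ (-j) := by
    have h := (semiconjBy_x (k := k) (p := p)).zpow_right j
    rw [inv_zpow'] at h
    exact h.eq.symm
  induction hg using Subgroup.closure_induction_right with
  | one => exact ⟨0, 0, by simp⟩
  | mul_right g _ s hs ih =>
    obtain ⟨i, j, rfl⟩ := ih
    obtain ⟨n, rfl⟩ := hs
    fin_cases n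
    · exact ⟨i + 1, -j, by
        rw [zpow_add_one, mul_assoc, mul_assoc]; exact congrArg _ (hyx j)⟩
    · exact ⟨i, j + 1, by rw [zpow_add_one, mul_assoc]; rfl⟩
  | mul_inv_cancel g _ s hs ih =>
    obtain ⟨i, j, rfl⟩ := ih
    obtain ⟨n, rfl⟩ := hs
    fin_cases n
    · refine ⟨i - 1, -j, ?_⟩
      rw [mul_inv_eq_iff_eq_mul, mul_assoc]
      change _ = _ * (y k p ^ (-j) * x k p)
      rw [hyx, neg_neg, ← mul_assoc, ← zpow_add_one, sub_add_cancel]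
    · exact ⟨i, j - 1, by rw [zpow_sub_one, mul_assoc]; rfl⟩

theorem commute_x_sq_y : Commute (x k p ^ 2) (y k p) := by
  have h := semiconjBy_x (k := k) (p := p)
  have hinv := h.inv_right
  rw [inv_inv] at hinv
  rw [pow_two]
  exact h.mul_left hinv

/-- For `k ≥ 1`, reduction modulo `8` of the exponent of `x`. -/
def exponentMod (hk : 1 ≤ k) : DPrime k p →* Multiplicative (ZMod 8) :=
  PresentedGroup.toGroup (f := ![Multiplicative.ofAdd 1, 1]) (by
    obtain ⟨m, rfl⟩ := Nat.exists_eq_add_of_le hk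
    rintro r (rfl | rfl | rfl)
    · have h : (Multiplicative.ofAdd (1 : ZMod 8)) ^ 8 = 1 := by decide
      simp [show 2 ^ (1 + m + 2) = 8 * 2 ^ m by ring, pow_mul, h]
    · simp
    · simp)

theorem exists_eq_sq_zpow_mul_zpow (hk : 1 ≤ k) {g : DPrime k p}
    (hg : exponentMod hk g ^ 4 = 1) : ∃ i j : ℤ, g = (x k p ^ 2) ^ i * y k p ^ j := by
  obtain ⟨i, j, rfl⟩ := exists_eq_zpow_mul_zpow g
  have hx : exponentMod hk (x k p) = Multiplicative.ofAdd 1 := PresentedGroup.toGroup.of _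
  have hy : exponentMod hk (y k p) = 1 := PresentedGroup.toGroup.of _
  rw [map_mul, map_zpow, map_zpow, hx, hy, one_zpow, mul_one, ← ofAdd_zsmul, ← ofAdd_nsmul,
    ofAdd_eq_one] at hg
  have h8 : ((4 * i : ℤ) : ZMod 8) = 0 := by simpa using hg
  rw [ZMod.intCast_zmod_eq_zero_iff_dvd] at h8
  obtain ⟨m, rfl⟩ : (2 : ℤ) ∣ i := by omega
  exact ⟨m, j, by rw [zpow_mul]; norm_cast⟩

theorem commute_of_exponentMod_pow_four (hk : 1 ≤ k) {g h : DPrime k p}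
    (hg : exponentMod hk g ^ 4 = 1) (hh : exponentMod hk h ^ 4 = 1) : Commute g h := by
  obtain ⟨i, j, rfl⟩ := exists_eq_sq_zpow_mul_zpow hk hg
  obtain ⟨m, n, rfl⟩ := exists_eq_sq_zpow_mul_zpow hk hh
  have hc (r s : ℤ) : Commute ((x k p ^ 2) ^ r) (y k p ^ s) := commute_x_sq_y.zpow_zpow r s
  exact ((Commute.zpow_zpow_self _ i m).mul_right (hc i n)).mul_left
    ((hc m j).symm.mul_right (Commute.zpow_zpow_self _ j n))

end DPrime

/-- For `k ≥ 1` and odd `p ≥ 3`, the group `D'_{2^{k+2} p}` contains no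
binary dihedral subgroups: for every `b ≥ 2` there is no injective group homomorphism
from `D*_{4b} = QuaternionGroup b` into `D'_{2^{k+2} p}`. -/
theorem stmt_6 (k p : ℕ) (hk : 1 ≤ k) (hp : 3 ≤ p) (hodd : Odd p) (b : ℕ) (hb : 2 ≤ b) :
    ¬ ∃ φ : QuaternionGroup b →* DPrime k p, Function.Injective φ := by
  rintro ⟨φ, hφ⟩
  let A : QuaternionGroup b := .a 1
  let X : QuaternionGroup b := .xa 0
  have hA : DPrime.exponentMod hk (φ A) ^ 4 = 1 := by
    have h : A * X * A = X := by simp [A, X]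
    have hf := congrArg (fun g ↦ DPrime.exponentMod hk (φ g)) h
    simp only [map_mul] at hf
    rw [mul_right_comm, mul_eq_right, ← pow_two] at hf
    rw [show 4 = 2 * 2 from rfl, pow_mul, hf, one_pow]
  have hX : DPrime.exponentMod hk (φ X) ^ 4 = 1 := by
    have : X ^ 4 = 1 := by
      have : NeZero b := ⟨by omega⟩
      rw [← QuaternionGroup.orderOf_xa (n := b) 0, pow_orderOf_eq_one]
    rw [← map_pow, ← map_pow, this, map_one, map_one]
  have hAX : A * X = X * A := hφ (by
    rw [map_mul, map_mul]
    exact DPrime.commute_of_exponentMod_pow_four hk hA hX)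
  have h1 : (0 - 1 : ZMod (2 * b)) = 0 + 1 := QuaternionGroup.xa.inj hAX
  have h2 : ((2 : ℕ) : ZMod (2 * b)) = 0 := by
    push_cast
    linear_combination -h1
  rw [ZMod.natCast_eq_zero_iff] at h2
  have := Nat.le_of_dvd two_pos h2
  omega
end

section
/- Let v ≥ 1 be an integer. The group T'_{8·3^v} contains no binary dihedral subgroups D*_{4b} with b > 2: for every integer b ≥ 3 there is no injective group homomorphism from the binary dihedral group D*_{4b} into T'_{8·3^v}. -/
/-- Relators for the group
`T'_{8·3^v} = ⟨x, p, q ∣ x^(3^v) = p⁴ = 1, p² = q², x q x⁻¹ = p q, x p x⁻¹ = q, p q p⁻¹ = q⁻¹⟩`,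
with generator `0` playing the role of `x`, generator `1` the role of `p`, and
generator `2` the role of `q`. -/
def tPrimeRels (v : ℕ) : Set (FreeGroup (Fin 3)) :=
  {FreeGroup.of 0 ^ 3 ^ v,
   FreeGroup.of 1 ^ 4,
   FreeGroup.of 1 ^ 2 * (FreeGroup.of 2 ^ 2)⁻¹,
   FreeGroup.of 0 * FreeGroup.of 2 * (FreeGroup.of 0)⁻¹ * (FreeGroup.of 1 * FreeGroup.of 2)⁻¹,
   FreeGroup.of 0 * FreeGroup.of 1 * (FreeGroup.of 0)⁻¹ * (FreeGroup.of 2)⁻¹,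
   FreeGroup.of 1 * FreeGroup.of 2 * (FreeGroup.of 1)⁻¹ * FreeGroup.of 2}

/-- The group `T'_{8·3^v}`, presented as
`⟨x, p, q ∣ x^(3^v) = p⁴ = 1, p² = q², x q x⁻¹ = p q, x p x⁻¹ = q, p q p⁻¹ = q⁻¹⟩`. -/
abbrev TPrime (v : ℕ) : Type := PresentedGroup (tPrimeRels v)

section Relations

variable {G : Type*} [Group G] {x p q : G}

theorem zpow_mul_comm_of_conj_inv (h1 : p ^ 4 = 1) (h2 : p ^ 2 = q ^ 2)
    (h3 : p * q * p⁻¹ = q⁻¹) (i : ℤ) : q * p ^ i = p ^ (-i) * q := by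
  have hp : p⁻¹ * p⁻¹ = p * p := by
    rw [← mul_inv_rev, inv_eq_iff_mul_eq_one, ← h1]
    simp [pow_succ, mul_assoc]
  have hq : q⁻¹ = p * p * q := by
    rw [inv_eq_iff_mul_eq_one, ← mul_assoc]
    calc q * (p * p) * q = q * p ^ 2 * q := by rw [pow_two]
      _ = q ^ 2 * q ^ 2 := by rw [h2]; group
      _ = 1 := by rw [← h2, ← pow_add, h1]
  have h : SemiconjBy q p p⁻¹ := by
    have h4 : p * q = q⁻¹ * p := mul_inv_eq_iff_eq_mul.mp h3
    have h5 : q * p = p * q⁻¹ := by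
      rw [eq_mul_inv_iff_mul_eq, mul_assoc, h4, mul_inv_cancel_left]
    have h6 : p * (p * p) = p⁻¹ := by rw [← hp]; group
    rw [SemiconjBy, h5, hq, ← mul_assoc, h6]
  have := h.zpow_right i
  rwa [SemiconjBy, inv_zpow'] at this

theorem exists_zpow_mul_zpow_of_mem_closure (h1 : p ^ 4 = 1) (h2 : p ^ 2 = q ^ 2)
    (h3 : p * q * p⁻¹ = q⁻¹) {g : G} (hg : g ∈ Subgroup.closure {p, q}) :
    ∃ i j : ℤ, g = p ^ i * q ^ j := by
  have hcomm := zpow_mul_comm_of_conj_inv h1 h2 h3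
  induction hg using Subgroup.closure_induction_left with
  | one => exact ⟨0, 0, by simp⟩
  | mul_left y hy g _ ih =>
    obtain ⟨i, j, rfl⟩ := ih
    obtain rfl | rfl := hy
    · exact ⟨1 + i, j, by rw [zpow_add, zpow_one, mul_assoc]⟩
    · exact ⟨-i, 1 + j, by rw [← mul_assoc, hcomm, mul_assoc, zpow_add, zpow_one]⟩
  | inv_mul_cancel y hy g _ ih =>
    obtain ⟨i, j, rfl⟩ := ih
    obtain rfl | rfl := hy
    · exact ⟨-1 + i, j, by rw [zpow_add, zpow_neg_one, mul_assoc]⟩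
    · refine ⟨-i, -1 + j, ?_⟩
      rw [inv_mul_eq_iff_eq_mul, ← mul_assoc, hcomm, neg_neg, mul_assoc, zpow_add, zpow_neg_one,
        mul_inv_cancel_left]

theorem card_closure_pair_le_eight (h1 : p ^ 4 = 1) (h2 : p ^ 2 = q ^ 2)
    (h3 : p * q * p⁻¹ = q⁻¹) :
    Finite (Subgroup.closure {p, q}) ∧ Nat.card (Subgroup.closure {p, q}) ≤ 8 := by
  have hsub : (Subgroup.closure {p, q} : Set G) ⊆
      Set.range fun m : Fin 4 × Fin 2 => p ^ (m.1 : ℕ) * q ^ (m.2 : ℕ) := by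
    intro g hg
    obtain ⟨i, j, rfl⟩ := exists_zpow_mul_zpow_of_mem_closure h1 h2 h3 hg
    have hq : q ^ j = p ^ (2 * (j / 2)) * q ^ (j % 2) := by
      conv_lhs => rw [← Int.mul_ediv_add_emod j 2, zpow_add, zpow_mul]
      rw [zpow_mul, zpow_ofNat, zpow_ofNat, h2]
    refine ⟨(⟨((i + 2 * (j / 2)) % 4).toNat, by omega⟩, ⟨(j % 2).toNat, by omega⟩), ?_⟩
    simp only [← zpow_natCast]
    rw [Int.toNat_of_nonneg (by omega), Int.toNat_of_nonneg (by omega), hq, ← mul_assoc,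
      ← zpow_add]
    congr 1
    exact (zpow_eq_zpow_emod _ (by exact_mod_cast h1)).symm
  have hfin := (Set.finite_range fun m : Fin 4 × Fin 2 => p ^ (m.1 : ℕ) * q ^ (m.2 : ℕ))
  refine ⟨hfin.subset hsub, (Nat.card_mono hfin hsub).trans ?_⟩
  simpa using Finite.card_range_le fun m : Fin 4 × Fin 2 => p ^ (m.1 : ℕ) * q ^ (m.2 : ℕ)

theorem closure_pair_normal (hpq : x * q * x⁻¹ = p * q) (hp : x * p * x⁻¹ = q)
    (htop : Subgroup.closure {x, p, q} = ⊤) : (Subgroup.closure {p, q}).Normal := by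
  have hmp : p ∈ Subgroup.closure {p, q} := Subgroup.subset_closure (by simp)
  have hmq : q ∈ Subgroup.closure {p, q} := Subgroup.subset_closure (by simp)
  have hle : Subgroup.closure {p, q} ≤
      (Subgroup.closure {p, q}).comap (MulAut.conj x).toMonoidHom := by
    rw [Subgroup.closure_le]
    rintro g (rfl | rfl)
    · simpa [hp] using hmq
    · simpa [hpq] using mul_mem hmp hmq
  have hle' : Subgroup.closure {p, q} ≤
      (Subgroup.closure {p, q}).comap (MulAut.conj x⁻¹).toMonoidHom := by
    have e1 : x⁻¹ * q * x = p := by rw [← hp]; group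
    have e2 : x⁻¹ * p * x = q * p⁻¹ := by
      calc x⁻¹ * p * x = x⁻¹ * (p * q) * x * (x⁻¹ * q * x)⁻¹ := by group
        _ = q * p⁻¹ := by rw [e1, ← hpq]; group
    rw [Subgroup.closure_le]
    rintro g (rfl | rfl)
    · simpa [e2] using mul_mem hmq (inv_mem hmp)
    · simpa [e1] using hmp
  rw [← Subgroup.normalizer_eq_top_iff, eq_top_iff, ← htop, Subgroup.closure_le]
  rintro g (rfl | rfl | rfl)
  · refine Subgroup.mem_normalizer_iff.mpr fun h => ⟨fun hh => by simpa using hle hh, fun hh => ?_⟩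
    simpa [mul_assoc] using hle' hh
  · exact Subgroup.le_normalizer hmp
  · exact Subgroup.le_normalizer hmq

/-- A homomorphism killing `p` and `q` and injective on the powers of `x` has kernel
contained in `⟨p, q⟩`. -/
theorem ker_le_closure_pair {A : Type*} [Group A] (f : G →* A)
    (hpq : x * q * x⁻¹ = p * q) (hp : x * p * x⁻¹ = q)
    (htop : Subgroup.closure {x, p, q} = ⊤) (fp : f p = 1) (fq : f q = 1)
    (fx : ∀ k : ℤ, f x ^ k = 1 → x ^ k = 1) : f.ker ≤ Subgroup.closure {p, q} := by
  intro g hg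
  have := closure_pair_normal hpq hp htop
  have hsup : Subgroup.closure {p, q} ⊔ Subgroup.zpowers x = ⊤ := by
    rw [Subgroup.zpowers_eq_closure, ← Subgroup.closure_union, ← htop]
    congr 1
    ext; simp
  obtain ⟨n, hn, y, ⟨k, rfl⟩, rfl⟩ := Subgroup.mem_sup_of_normal_left.mp
    (hsup ▸ Subgroup.mem_top g)
  have hle : Subgroup.closure {p, q} ≤ f.ker := by
    rw [Subgroup.closure_le]
    rintro g (rfl | rfl) <;> assumption
  have hk : f x ^ k = 1 := by
    have hfn : f n = 1 := hle hn
    simpa [MonoidHom.mem_ker, hfn] using hg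
  simpa [fx k hk] using hn

end Relations

namespace TPrime

variable (v : ℕ)

/-- The exponent sum in `x`, read modulo `3 ^ v`. -/
def expX : TPrime v →* Multiplicative (ZMod (3 ^ v)) :=
  PresentedGroup.toGroup (f := ![Multiplicative.ofAdd 1, 1, 1]) (by
    simp only [tPrimeRels, Set.mem_insert_iff, Set.mem_singleton_iff]
    rintro r (rfl | rfl | rfl | rfl | rfl | rfl)
    · simp [← ofAdd_nsmul]
    all_goals simp)

theorem closure_generators : Subgroup.closure
    {(PresentedGroup.of 0 : TPrime v), PresentedGroup.of 1, PresentedGroup.of 2} = ⊤ := by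
  rw [← PresentedGroup.closure_range_of (tPrimeRels v)]
  congr 1
  ext g
  simp [Fin.exists_fin_succ, eq_comm]

theorem ker_expX : Finite (expX v).ker ∧ Nat.card (expX v).ker ≤ 8 := by
  have rel {r : FreeGroup (Fin 3)} (hr : r ∈ tPrimeRels v) :
      PresentedGroup.mk (tPrimeRels v) r = 1 :=
    PresentedGroup.one_of_mem hr
  have r0 : (PresentedGroup.of 0 : TPrime v) ^ 3 ^ v = 1 :=
    rel (r := FreeGroup.of 0 ^ 3 ^ v) (by simp [tPrimeRels])
  have r1 : (PresentedGroup.of 1 : TPrime v) ^ 4 = 1 :=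
    rel (r := FreeGroup.of 1 ^ 4) (by simp [tPrimeRels])
  have r2 : (PresentedGroup.of 1 : TPrime v) ^ 2 = PresentedGroup.of 2 ^ 2 :=
    mul_inv_eq_one.mp (rel (by simp [tPrimeRels]))
  have r3 : (PresentedGroup.of 0 : TPrime v) * PresentedGroup.of 2 * (PresentedGroup.of 0)⁻¹ =
      PresentedGroup.of 1 * PresentedGroup.of 2 :=
    mul_inv_eq_one.mp (rel (by simp [tPrimeRels]))
  have r4 : (PresentedGroup.of 0 : TPrime v) * PresentedGroup.of 1 * (PresentedGroup.of 0)⁻¹ =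
      PresentedGroup.of 2 :=
    mul_inv_eq_one.mp (rel (by simp [tPrimeRels]))
  have r5 : (PresentedGroup.of 1 : TPrime v) * PresentedGroup.of 2 * (PresentedGroup.of 1)⁻¹ =
      (PresentedGroup.of 2)⁻¹ :=
    eq_inv_of_mul_eq_one_left (rel (by simp [tPrimeRels]))
  have hle := ker_le_closure_pair (expX v) r3 r4 (closure_generators v)
    (by simp [expX]) (by simp [expX]) (fun k hk => by
      have hk' : ((k : ℤ) : ZMod (3 ^ v)) = 0 := by
        simpa [expX, ← ofAdd_zsmul] using hk
      obtain ⟨m, rfl⟩ := (ZMod.intCast_zmod_eq_zero_iff_dvd _ _).mp hk'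
      rw [zpow_mul, zpow_natCast, r0, one_zpow])
  obtain ⟨hfin, hcard⟩ := card_closure_pair_le_eight r1 r2 r5
  exact ⟨Finite.Set.subset _ hle, (Nat.card_mono hfin hle).trans hcard⟩

end TPrime

/-- In an abelian group with no elements of order two, a homomorphism from a dicyclic group
is trivial. -/
theorem QuaternionGroup.monoidHom_eq_one {A : Type*} [CommGroup A]
    (hA : ∀ y : A, y ^ 2 = 1 → y = 1) {b : ℕ} (f : QuaternionGroup b →* A)
    (g : QuaternionGroup b) : f g = 1 := by
  cases g with
  | a i =>
    apply hA
    have h : f (a i * xa 0 * a i) = f (xa 0) := by congr 1; simp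
    rw [map_mul, map_mul, mul_right_comm, ← pow_two] at h
    exact mul_eq_right.mp h
  | xa i =>
    refine hA _ (hA _ ?_)
    rw [← pow_mul, ← map_pow, xa_pow_four, map_one]

/-- For `v ≥ 1`, the group `T'_{8·3^v}` contains no binary dihedral
subgroups `D*_{4b}` with `b > 2`: for every `b ≥ 3`, there is no injective group
homomorphism from `D*_{4b} = QuaternionGroup b` into `T'_{8·3^v}`. -/
theorem stmt_10 (v : ℕ) (hv : 1 ≤ v) (b : ℕ) (hb : 3 ≤ b) :
    ¬ ∃ φ : QuaternionGroup b →* TPrime v, Function.Injective φ := by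
  rintro ⟨φ, hφ⟩
  have hA : ∀ y : Multiplicative (ZMod (3 ^ v)), y ^ 2 = 1 → y = 1 := by
    intro y hy
    have h3 : y ^ 3 ^ v = 1 := by
      have := pow_card_eq_one' (x := y)
      rwa [Nat.card_congr Multiplicative.toAdd, Nat.card_zmod] at this
    have hcop : Nat.Coprime 2 (3 ^ v) := Nat.Coprime.pow_right v (by norm_num)
    exact (pow_eq_one_iff_of_coprime hcop).mp ⟨hy, h3⟩
  have hmem (g : QuaternionGroup b) : φ g ∈ (TPrime.expX v).ker :=
    QuaternionGroup.monoidHom_eq_one hA ((TPrime.expX v).comp φ) g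
  obtain ⟨hfin, hcard⟩ := TPrime.ker_expX v
  have : NeZero b := ⟨by omega⟩
  have hle := Nat.card_le_card_of_injective _ ((φ.injective_codRestrict _ hmem).mpr hφ)
  rw [Nat.card_eq_fintype_card, QuaternionGroup.card] at hle
  omega
end

section
/- Let v ≥ 1 be an integer. In the group T'_{8·3^v}, the element x³ commutes with the generators p and q; consequently the cyclic subgroup generated by x³ is contained in the center of T'_{8·3^v}. -/
section Conjugation

variable {G : Type*} [Group G] {x p q : G}

theorem semiconjBy_sq_of_tPrime_relations (hq : SemiconjBy x q (p * q))
    (hp : SemiconjBy x p q) (hpq : q * (p * q) = p) : SemiconjBy (x ^ 2) q p := by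
  have h := (hp.mul_right hq).mul_left hq
  rwa [hpq, ← sq] at h

theorem commute_pow_three_left_of_tPrime_relations (hq : SemiconjBy x q (p * q))
    (hp : SemiconjBy x p q) (hpq : q * (p * q) = p) : Commute (x ^ 3) p := by
  have h := (semiconjBy_sq_of_tPrime_relations hq hp hpq).mul_left hp
  rwa [← pow_succ] at h

theorem commute_pow_three_right_of_tPrime_relations (hq : SemiconjBy x q (p * q))
    (hp : SemiconjBy x p q) (hpq : q * (p * q) = p) : Commute (x ^ 3) q := by
  have h := hp.mul_left (semiconjBy_sq_of_tPrime_relations hq hp hpq)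
  rwa [← pow_succ'] at h

end Conjugation

namespace TPrime

theorem semiconjBy_of_zero_of_two (v : ℕ) :
    SemiconjBy (PresentedGroup.of 0 : TPrime v) (PresentedGroup.of 2)
      (PresentedGroup.of 1 * PresentedGroup.of 2) := by
  have h := PresentedGroup.one_of_mem (rels := tPrimeRels v)
    (x := FreeGroup.of 0 * FreeGroup.of 2 * (FreeGroup.of 0)⁻¹ *
      (FreeGroup.of 1 * FreeGroup.of 2)⁻¹) (by simp [tPrimeRels])
  simp only [map_mul, map_inv] at h
  exact mul_inv_eq_iff_eq_mul.mp (mul_inv_eq_one.mp h)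

theorem semiconjBy_of_zero_of_one (v : ℕ) :
    SemiconjBy (PresentedGroup.of 0 : TPrime v) (PresentedGroup.of 1)
      (PresentedGroup.of 2) := by
  have h := PresentedGroup.one_of_mem (rels := tPrimeRels v)
    (x := FreeGroup.of 0 * FreeGroup.of 1 * (FreeGroup.of 0)⁻¹ * (FreeGroup.of 2)⁻¹)
    (by simp [tPrimeRels])
  simp only [map_mul, map_inv] at h
  exact mul_inv_eq_iff_eq_mul.mp (mul_inv_eq_one.mp h)

theorem of_two_mul_of_one_mul_of_two (v : ℕ) :
    (PresentedGroup.of 2 : TPrime v) * (PresentedGroup.of 1 * PresentedGroup.of 2) =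
      PresentedGroup.of 1 := by
  have h := PresentedGroup.one_of_mem (rels := tPrimeRels v)
    (x := FreeGroup.of 1 * FreeGroup.of 2 * (FreeGroup.of 1)⁻¹ * FreeGroup.of 2)
    (by simp [tPrimeRels])
  simp only [map_mul, map_inv] at h
  exact mul_inv_eq_one.mp ((mul_assoc _ _ _).trans (mul_eq_one_comm.mp h))

end TPrime

/-- For `v ≥ 1`, in the group `T'_{8·3^v}` the element `x³` commutes with
the generators `p` and `q`; consequently the cyclic subgroup generated by `x³` is
contained in the center of `T'_{8·3^v}`. -/
theorem stmt_11 (v : ℕ) (hv : 1 ≤ v) :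
    ((PresentedGroup.of 0 : TPrime v) ^ 3 * PresentedGroup.of 1
        = PresentedGroup.of 1 * (PresentedGroup.of 0 : TPrime v) ^ 3) ∧
    ((PresentedGroup.of 0 : TPrime v) ^ 3 * PresentedGroup.of 2
        = PresentedGroup.of 2 * (PresentedGroup.of 0 : TPrime v) ^ 3) ∧
    Subgroup.zpowers ((PresentedGroup.of 0 : TPrime v) ^ 3)
        ≤ Subgroup.center (TPrime v) := by
  have hq := TPrime.semiconjBy_of_zero_of_two v
  have hp := TPrime.semiconjBy_of_zero_of_one v
  have hpq := TPrime.of_two_mul_of_one_mul_of_two v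
  have h₁ := commute_pow_three_left_of_tPrime_relations hq hp hpq
  have h₂ := commute_pow_three_right_of_tPrime_relations hq hp hpq
  refine ⟨h₁, h₂, ?_⟩
  rw [Subgroup.zpowers_le, ← Subgroup.centralizer_univ, ← Subgroup.coe_top,
    ← PresentedGroup.closure_range_of, Subgroup.centralizer_closure,
    Subgroup.mem_centralizer_iff]
  rintro _ ⟨i, rfl⟩
  fin_cases i
  exacts [Commute.self_pow _ 3, h₁.symm, h₂.symm]
end

section
/- Let G be a group with a normal subgroup N isomorphic to the binary icosahedral group I* = SL(2, ℤ/5) such that N has index 3 in G (i.e. G is an extension 1 → I* → G → ℤ/3 → 1). Then G is isomorphic to the direct product SL(2, ℤ/5) × ℤ/3. -/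
open Matrix in
/-- The matrix `(0, -1; 1, 0)` in `SL(2, ℤ/5)`. -/
def sl2S : SpecialLinearGroup (Fin 2) (ZMod 5) := ⟨!![0, -1; 1, 0], by decide⟩

open Matrix in
/-- The matrix `(1, 1; 0, 1)` in `SL(2, ℤ/5)`. -/
def sl2T : SpecialLinearGroup (Fin 2) (ZMod 5) := ⟨!![1, 1; 0, 1], by decide⟩

open Matrix in
theorem exists_eq_word_sl2S_sl2T : ∀ a b c d : ZMod 5, a * d - b * c = 1 →
    ∃ i j k : Fin 5,
      !![a, b; c, d] = (sl2T ^ i.val * sl2S * sl2T ^ j.val * sl2S * sl2T ^ k.val).val ∨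
      !![a, b; c, d] = (sl2S * (sl2T ^ i.val * sl2S * sl2T ^ j.val * sl2S * sl2T ^ k.val)).val := by
  decide +kernel

open Matrix in
theorem closure_sl2S_sl2T : Subgroup.closure {sl2S, sl2T} = ⊤ := by
  rw [eq_top_iff]
  intro z _
  have hS : sl2S ∈ Subgroup.closure {sl2S, sl2T} := Subgroup.subset_closure (by simp)
  have hT : sl2T ∈ Subgroup.closure {sl2S, sl2T} := Subgroup.subset_closure (by simp)
  have hdet : z 0 0 * z 1 1 - z 0 1 * z 1 0 = 1 := by
    rw [← Matrix.det_fin_two]; exact z.2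
  have hW (i j k : ℕ) : sl2T ^ i * sl2S * sl2T ^ j * sl2S * sl2T ^ k ∈
      Subgroup.closure {sl2S, sl2T} :=
    mul_mem (mul_mem (mul_mem (mul_mem (pow_mem hT i) hS) (pow_mem hT j)) hS) (pow_mem hT k)
  obtain ⟨i, j, k, h | h⟩ := exists_eq_word_sl2S_sl2T _ _ _ _ hdet
  all_goals
    rw [← Matrix.eta_fin_two] at h
    rw [Subtype.ext h]
  · exact hW i j k
  · exact mul_mem hS (hW i j k)

open Matrix in
theorem exists_mul_eq_mul_sl2T : ∀ a b c d : ZMod 5, !![a, b; c, d] ^ 5 = 1 →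
    !![a, b; c, d] ≠ 1 → ∃ p q r s : ZMod 5, p * s - q * r ≠ 0 ∧
      !![a, b; c, d] * !![p, q; r, s] = !![p, q; r, s] * sl2T.val := by
  decide +kernel

open Matrix in
theorem exists_mul_eq_mul_sl2S : ∀ a b c d : ZMod 5, !![a, b; c, d] ^ 2 = -1 →
    (!![a, b; c, d] * sl2T.val) ^ 3 = -1 → ∃ k : ZMod 5,
      !![a, b; c, d] * !![1, k; 0, 1] = !![1, k; 0, 1] * sl2S.val := by
  decide +kernel

open Matrix in
theorem eq_neg_one_of_sq_eq_one : ∀ a b c d : ZMod 5, a * d - b * c = 1 →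
    !![a, b; c, d] ^ 2 = 1 → !![a, b; c, d] ≠ 1 → !![a, b; c, d] = -1 := by
  decide +kernel

open Matrix in
theorem mulEquiv_neg_one (φ : MulAut (SpecialLinearGroup (Fin 2) (ZMod 5))) :
    φ (-1) = -1 := by
  set z := φ (-1) with hz
  have hdet : z 0 0 * z 1 1 - z 0 1 * z 1 0 = 1 := by
    rw [← Matrix.det_fin_two]; exact z.2
  have h2 : z ^ 2 = 1 := by rw [hz, ← map_pow]; simp
  have h1 : z ≠ 1 := by
    rw [hz]
    simp only [ne_eq, EmbeddingLike.map_eq_one_iff]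
    decide
  have key := eq_neg_one_of_sq_eq_one _ _ _ _ hdet
  rw [← Matrix.eta_fin_two] at key
  refine Subtype.ext ((key ?_ ?_).trans (by simp))
  · simpa using congrArg Subtype.val h2
  · exact fun h => h1 (Subtype.ext h)

open Matrix in
/-- Every automorphism of `SL(2, ℤ/5)` is conjugation by an element of `GL(2, ℤ/5)`. -/
theorem exists_matrix_conj (φ : MulAut (SpecialLinearGroup (Fin 2) (ZMod 5))) :
    ∃ Q : Matrix (Fin 2) (Fin 2) (ZMod 5), Q.det ≠ 0 ∧
      ∀ z, (φ z).val * Q = Q * z.val := by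
  have : Fact (Nat.Prime 5) := ⟨by norm_num⟩
  obtain ⟨P, hP, hPT⟩ : ∃ P : Matrix (Fin 2) (Fin 2) (ZMod 5), P.det ≠ 0 ∧
      (φ sl2T).val * P = P * sl2T.val := by
    have key := exists_mul_eq_mul_sl2T (φ sl2T 0 0) (φ sl2T 0 1) (φ sl2T 1 0) (φ sl2T 1 1)
    rw [← Matrix.eta_fin_two] at key
    obtain ⟨p, q, r, s, hd, h⟩ := key
      (by
        have : φ sl2T ^ 5 = 1 := by
          rw [← map_pow, show sl2T ^ 5 = 1 by decide +kernel, map_one]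
        simpa using congrArg Subtype.val this)
      (fun h => by
        have : φ sl2T = 1 := Subtype.ext h
        rw [EmbeddingLike.map_eq_one_iff] at this
        exact absurd this (by decide))
    exact ⟨!![p, q; r, s], by rwa [Matrix.det_fin_two_of], h⟩
  have hPu : IsUnit P.det := hP.isUnit
  have hX2 : (φ sl2S).val ^ 2 = -1 := by
    have : φ sl2S ^ 2 = -1 := by
      rw [← map_pow, show sl2S ^ 2 = -1 by decide +kernel, mulEquiv_neg_one]
    simpa using congrArg Subtype.val this
  have hXT : ((φ sl2S).val * (φ sl2T).val) ^ 3 = -1 := by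
    have : (φ sl2S * φ sl2T) ^ 3 = -1 := by
      rw [← map_mul, ← map_pow, show (sl2S * sl2T) ^ 3 = -1 by decide +kernel, mulEquiv_neg_one]
    simpa using congrArg Subtype.val this
  have hconj (A : Matrix (Fin 2) (Fin 2) (ZMod 5)) (n : ℕ) (hA : A ^ n = -1) :
      (P⁻¹ * A * P) ^ n = -1 := by
    have h (m : ℕ) : (P⁻¹ * A * P) ^ m = P⁻¹ * A ^ m * P := by
      induction m with
      | zero => simp [Matrix.nonsing_inv_mul _ hPu]
      | succ m ih =>
        rw [pow_succ, ih, pow_succ]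
        simp only [Matrix.mul_assoc]
        rw [Matrix.mul_nonsing_inv_cancel_left _ _ hPu]
    rw [h, hA]
    simp [Matrix.nonsing_inv_mul _ hPu]
  obtain ⟨k, hk⟩ : ∃ k : ZMod 5, P⁻¹ * (φ sl2S).val * P * !![1, k; 0, 1] =
      !![1, k; 0, 1] * sl2S.val := by
    set x := P⁻¹ * (φ sl2S).val * P with hx
    have key := exists_mul_eq_mul_sl2S (x 0 0) (x 0 1) (x 1 0) (x 1 1)
    rw [← Matrix.eta_fin_two] at key
    refine key (hconj _ _ hX2) ?_
    have : x * sl2T.val = P⁻¹ * ((φ sl2S).val * (φ sl2T).val) * P := by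
      simp only [hx, Matrix.mul_assoc, hPT]
    rw [this]
    exact hconj _ _ hXT
  refine ⟨P * !![1, k; 0, 1], by simpa [Matrix.det_fin_two_of] using hP, fun z => ?_⟩
  have hmul (y w : SpecialLinearGroup (Fin 2) (ZMod 5)) : (y * w).val = y.val * w.val := rfl
  have hz : z ∈ Subgroup.closure {sl2S, sl2T} := by rw [closure_sl2S_sl2T]; trivial
  induction hz using Subgroup.closure_induction with
  | mem y hy =>
    rcases hy with rfl | rfl
    · rw [Matrix.mul_assoc P, ← hk]
      simp only [Matrix.mul_assoc]
      rw [Matrix.mul_nonsing_inv_cancel_left _ _ hPu]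
    · rw [← Matrix.mul_assoc, hPT, Matrix.mul_assoc, Matrix.mul_assoc]
      congr 1
      simp [sl2T, add_comm]
  | one => simp
  | mul y w _ _ hy hw =>
    rw [map_mul, hmul, hmul, Matrix.mul_assoc, hw, ← Matrix.mul_assoc, hy, Matrix.mul_assoc]
  | inv y _ hy =>
    set Q := P * !![1, k; 0, 1]
    have h1 : (φ y⁻¹).val * (φ y).val = 1 := by
      rw [← hmul, ← map_mul]; simp
    have h2 : y.val * (y⁻¹).val = 1 := by
      rw [← hmul]; simp
    calc (φ y⁻¹).val * Q = (φ y⁻¹).val * (Q * y.val) * (y⁻¹).val := by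
          rw [Matrix.mul_assoc, Matrix.mul_assoc, h2, Matrix.mul_one]
      _ = Q * (y⁻¹).val := by rw [← hy, ← Matrix.mul_assoc, h1, Matrix.one_mul]

open Matrix in
/-- The outer automorphism group of `SL(2, ℤ/5)` has exponent dividing `2`. -/
theorem exists_sq_eq_conj (φ : MulAut (SpecialLinearGroup (Fin 2) (ZMod 5))) :
    ∃ r, φ ^ 2 = MulAut.conj r := by
  have : Fact (Nat.Prime 5) := ⟨by norm_num⟩
  obtain ⟨Q, hQ, h⟩ := exists_matrix_conj φ
  let R : SpecialLinearGroup (Fin 2) (ZMod 5) := ⟨Q.det⁻¹ • (Q * Q), by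
    rw [Matrix.det_smul, Matrix.det_mul, Fintype.card_fin]
    field_simp⟩
  refine ⟨R, MulEquiv.ext fun z => ?_⟩
  rw [MulAut.conj_apply, eq_mul_inv_iff_mul_eq]
  refine Subtype.ext ?_
  change (φ (φ z)).val * (Q.det⁻¹ • (Q * Q)) = (Q.det⁻¹ • (Q * Q)) * z.val
  rw [Matrix.mul_smul, Matrix.smul_mul, ← Matrix.mul_assoc, h, Matrix.mul_assoc, h,
    Matrix.mul_assoc]

open Matrix in
theorem sq_eq_one_of_forall_commute (z : SpecialLinearGroup (Fin 2) (ZMod 5))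
    (hz : ∀ w, w * z = z * w) : z ^ 2 = 1 := by
  have key : ∀ a b c d : ZMod 5, a * d - b * c = 1 →
      sl2S.val * !![a, b; c, d] = !![a, b; c, d] * sl2S.val →
      sl2T.val * !![a, b; c, d] = !![a, b; c, d] * sl2T.val → !![a, b; c, d] ^ 2 = 1 := by
    decide +kernel
  have hdet : z 0 0 * z 1 1 - z 0 1 * z 1 0 = 1 := by
    rw [← Matrix.det_fin_two]; exact z.2
  have := key _ _ _ _ hdet
  rw [← Matrix.eta_fin_two] at this
  refine Subtype.ext ?_
  simpa using this (congrArg Subtype.val (hz sl2S)) (congrArg Subtype.val (hz sl2T))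

/-- If every automorphism of `H` has an inner square and the center of `H` has exponent
dividing `2`, then a group containing a copy of `H` as a normal subgroup of index `3` is the
direct product of `H` and the cyclic group of order `3`. -/
theorem nonempty_mulEquiv_prod_of_index_eq_three {G H : Type*} [Group G] [Group H]
    (N : Subgroup G) (hN : N.Normal) (e : N ≃* H) (hidx : N.index = 3)
    (hout : ∀ φ : MulAut H, ∃ r, φ ^ 2 = MulAut.conj r)
    (hcen : ∀ z : H, (∀ w, w * z = z * w) → z ^ 2 = 1) :
    Nonempty (G ≃* H × Multiplicative (ZMod 3)) := by
  have hout' (φ : MulAut N) : ∃ r, φ ^ 2 = MulAut.conj r := by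
    obtain ⟨r, hr⟩ := hout (MulAut.congr e φ)
    refine ⟨e.symm r, MulEquiv.ext fun n => e.injective ?_⟩
    have := DFunLike.congr_fun hr (e n)
    simpa [sq, MulAut.congr] using this
  have hcube (g : G) : g ^ 3 ∈ N := hidx ▸ N.pow_index_mem g
  obtain ⟨g, hg⟩ : ∃ g, g ∉ N := by
    by_contra! h
    rw [(Subgroup.eq_top_iff' N).2 h, Subgroup.index_top] at hidx
    omega
  obtain ⟨r, hr⟩ := hout' (MulAut.conjNormal g)
  have hrn (n : G) (hn : n ∈ N) : g ^ 2 * n * (g ^ 2)⁻¹ = r * n * (r : G)⁻¹ := by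
    have := congrArg Subtype.val (DFunLike.congr_fun hr ⟨n, hn⟩)
    rwa [← map_pow, MulAut.conjNormal_apply, MulAut.conj_apply] at this
  obtain ⟨d, hdN, hd⟩ : ∃ d, d ∉ N ∧ ∀ n ∈ N, Commute d n := by
    refine ⟨(r : G)⁻¹ * g ^ 2, fun h => hg ?_, fun n hn => ?_⟩
    · have h2 : g ^ 2 ∈ N := (N.mul_mem_cancel_left (N.inv_mem r.2)).1 h
      have h3 := hcube g
      rw [pow_succ] at h3
      exact (N.mul_mem_cancel_left h2).1 h3
    · have := hrn n hn
      rw [mul_inv_eq_iff_eq_mul] at this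
      rw [Commute, SemiconjBy, mul_assoc, this]
      group
  have hd6 : d ^ 6 = 1 := by
    let z : N := ⟨d ^ 3, hcube d⟩
    have hz : (e z) ^ 2 = 1 := by
      refine hcen _ fun w => ?_
      obtain ⟨n, rfl⟩ := e.surjective w
      rw [← map_mul, ← map_mul]
      exact congrArg e (Subtype.ext ((hd n n.2).pow_left 3).symm.eq)
    rw [← map_pow, EmbeddingLike.map_eq_one_iff] at hz
    simpa [z, ← pow_mul] using congrArg Subtype.val hz
  let c := d ^ 2
  have hc3 : c ^ 3 = 1 := by rw [← pow_mul]; exact hd6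
  have hcN : c ∉ N := fun h => hdN <| by
    have h3 := hcube d
    rw [pow_succ] at h3
    exact (N.mul_mem_cancel_left h).1 h3
  have hc (n : G) (hn : n ∈ N) : Commute c n := (hd n hn).pow_left 2
  let γ : Multiplicative (ZMod 3) →* G :=
    AddMonoidHom.toMultiplicativeLeft (ZMod.lift 3 ⟨zmultiplesHom (Additive G) (.ofMul c), by
      change c ^ (3 : ℤ) = 1
      exact_mod_cast hc3⟩)
  have hγ (m : ℕ) : γ (.ofAdd (m : ZMod 3)) = c ^ m := by
    have hm : (m : ZMod 3) = ((m : ℤ) : ZMod 3) := by simp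
    rw [hm]
    exact (congrArg Additive.toMul (ZMod.lift_coe 3 _ (m : ℤ))).trans (zpow_natCast c m)
  have hγ' (x : Multiplicative (ZMod 3)) : ∃ m : ℕ, m < 3 ∧ x = .ofAdd (m : ZMod 3) :=
    ⟨ZMod.val x.toAdd, ZMod.val_lt _, by simp⟩
  let f : N × Multiplicative (ZMod 3) →* G := N.subtype.noncommCoprod γ fun n x => by
    obtain ⟨m, -, rfl⟩ := hγ' x
    rw [hγ]
    exact ((hc n n.2).pow_left m).symm
  have hfinj : Function.Injective f := by
    rw [injective_iff_map_eq_one]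
    rintro ⟨n, x⟩ h
    obtain ⟨m, hm, rfl⟩ := hγ' x
    have h' : (n : G) * c ^ m = 1 := by simpa [f, hγ] using h
    have hcm : c ^ m ∈ N := by
      rw [← N.mul_mem_cancel_left n.2, h']; exact N.one_mem
    have hm0 : m = 0 := by
      interval_cases m
      · rfl
      · exact absurd (by simpa using hcm) hcN
      · have h3 := hcube c
        rw [pow_succ] at h3
        exact absurd ((N.mul_mem_cancel_left hcm).1 h3) hcN
    subst hm0
    simpa using h'
  have hfsurj : Function.Surjective f := by
    have hle : N ≤ f.range := fun n hn => ⟨(⟨n, hn⟩, 1), by simp [f]⟩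
    have hmul := Subgroup.relIndex_mul_index hle
    rw [hidx] at hmul
    rw [← MonoidHom.range_eq_top, ← Subgroup.index_eq_one]
    refine ((Nat.dvd_prime Nat.prime_three).1 (Dvd.intro_left _ hmul)).resolve_right fun h3 => ?_
    have h1 : N.relIndex f.range = 1 := by rw [h3] at hmul; omega
    refine hcN (Subgroup.relIndex_eq_one.1 h1 ⟨(1, .ofAdd ((1 : ℕ) : ZMod 3)), ?_⟩)
    simpa [f] using hγ 1
  exact ⟨(MulEquiv.ofBijective f ⟨hfinj, hfsurj⟩).symm.trans (e.prodCongr (.refl _))⟩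

/-- If a group `G` has a normal subgroup `N` isomorphic to the binary
icosahedral group `I* = SL(2, ℤ/5)` with `N` of index 3 in `G` (i.e. `G` is an extension
`1 → I* → G → ℤ/3 → 1`), then `G` is isomorphic to the direct product
`SL(2, ℤ/5) × ℤ/3`. -/
theorem stmt_12 (G : Type*) [Group G] (N : Subgroup G) (hN : N.Normal)
    (hiso : Nonempty (N ≃* Matrix.SpecialLinearGroup (Fin 2) (ZMod 5)))
    (hidx : N.index = 3) :
    Nonempty (G ≃* Matrix.SpecialLinearGroup (Fin 2) (ZMod 5) × Multiplicative (ZMod 3)) := by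
  obtain ⟨e⟩ := hiso
  exact nonempty_mulEquiv_prod_of_index_eq_three N hN e hidx exists_sq_eq_conj
    sq_eq_one_of_forall_commute
end

section
/- Let G be a group with a normal subgroup N isomorphic to the binary tetrahedral group T* = SL(2, ℤ/3) such that N has index 7 in G (i.e. G is an extension 1 → T* → G → ℤ/7 → 1). Then G is isomorphic to the direct product ℤ/7 × SL(2, ℤ/3). -/
theorem card_pow_four_eq_one_and_sq_ne_one :
    Fintype.card {x : Matrix.SpecialLinearGroup (Fin 2) (ZMod 3) // x ^ 4 = 1 ∧ x ^ 2 ≠ 1} = 6 := by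
  decide +kernel

theorem card_specialLinearGroup_two_zmod_three :
    Fintype.card (Matrix.SpecialLinearGroup (Fin 2) (ZMod 3)) = 24 := by
  decide +kernel

/-- A permutation of fewer than `p` points whose `p`-th power is trivial is trivial. -/
theorem Equiv.Perm.eq_one_of_pow_prime_eq_one_of_card_lt {α : Type*} [Fintype α] {p : ℕ}
    (hp : p.Prime) (hα : Fintype.card α < p) (σ : Equiv.Perm α) (hσ : σ ^ p = 1) : σ = 1 := by
  classical
  have hcard : orderOf σ ∣ (Fintype.card α).factorial := by
    simpa [Fintype.card_perm] using orderOf_dvd_card (x := σ)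
  rcases (Nat.dvd_prime hp).1 (orderOf_dvd_of_pow_eq_one hσ) with h | h
  · exact orderOf_eq_one_iff.1 h
  · rw [h, hp.dvd_factorial] at hcard
    omega

/-- The order of the automorphism group of `SL(2, ℤ/3)` is prime to 7. -/
theorem mulAut_specialLinearGroup_two_zmod_three_eq_one
    (φ : MulAut (Matrix.SpecialLinearGroup (Fin 2) (ZMod 3))) (hφ : φ ^ 7 = 1) : φ = 1 := by
  let S := Matrix.SpecialLinearGroup (Fin 2) (ZMod 3)
  let σ : Equiv.Perm S := MulAut.toPerm S φ
  have hσ : σ ^ 7 = 1 := by rw [← map_pow, hφ, map_one]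
  have hinv : ∀ x, ((σ x) ^ 4 = 1 ∧ (σ x) ^ 2 ≠ 1) ↔ (x ^ 4 = 1 ∧ x ^ 2 ≠ 1) := by
    intro x
    change ((φ x) ^ 4 = 1 ∧ (φ x) ^ 2 ≠ 1) ↔ _
    simp only [← map_pow, ne_eq, EmbeddingLike.map_eq_one_iff]
  have hfix : ∀ x : S, x ^ 4 = 1 ∧ x ^ 2 ≠ 1 → φ x = x := by
    intro x hx
    have h := Equiv.Perm.eq_one_of_pow_prime_eq_one_of_card_lt (p := 7) (by norm_num)
      (by rw [card_pow_four_eq_one_and_sq_ne_one]; norm_num) (σ.subtypePerm hinv)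
      (by ext1 y; simp [Equiv.Perm.subtypePerm_pow, hσ])
    exact congrArg Subtype.val (Equiv.congr_fun h ⟨x, hx⟩)
  let F : Subgroup S := φ.toMonoidHom.eqLocus (MonoidHom.id S)
  have hFdvd : Nat.card F ∣ 24 := by
    have h := F.card_subgroup_dvd_card
    rwa [Nat.card_eq_fintype_card (α := S), card_specialLinearGroup_two_zmod_three] at h
  have hFmod : 24 ≡ Nat.card F [MOD 7] := by
    have : Fact (Nat.Prime 7) := ⟨by norm_num⟩
    have h := Equiv.Perm.card_compl_support_modEq (σ := σ) (p := 7) (n := 1) hσ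
    have hF : Nat.card F = σ.supportᶜ.card := by
      refine Nat.subtype_card _ fun x => ?_
      rw [Finset.mem_compl, Equiv.Perm.notMem_support]
      rfl
    rw [hF, ← card_specialLinearGroup_two_zmod_three]
    exact h.symm
  have hFle : 6 ≤ Nat.card F := by
    rw [← card_pow_four_eq_one_and_sq_ne_one, ← Nat.card_eq_fintype_card]
    exact Nat.card_le_card_of_injective (fun x => (⟨x.1, hfix x.1 x.2⟩ : F))
      fun x y h => Subtype.ext (congrArg (fun z : F => z.1) h)
  have hF : Nat.card F = 24 := by
    have hle := Nat.le_of_dvd (by norm_num) hFdvd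
    generalize Nat.card F = k at *
    unfold Nat.ModEq at hFmod
    interval_cases k <;> omega
  have hFtop : F = ⊤ := Subgroup.eq_top_of_card_eq F (by
    rw [hF, Nat.card_eq_fintype_card, card_specialLinearGroup_two_zmod_three])
  ext1 x
  exact (hFtop ▸ Subgroup.mem_top x : x ∈ F)

/-- If a group `G` has a normal subgroup `N` isomorphic to the binary
tetrahedral group `T* = SL(2, ℤ/3)` with `N` of index 7 in `G` (i.e. `G` is an extension
`1 → T* → G → ℤ/7 → 1`), then `G` is isomorphic to the direct product
`ℤ/7 × SL(2, ℤ/3)`. -/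
theorem stmt_13 (G : Type*) [Group G] (N : Subgroup G) (hN : N.Normal)
    (hiso : Nonempty (N ≃* Matrix.SpecialLinearGroup (Fin 2) (ZMod 3)))
    (hidx : N.index = 7) :
    Nonempty (G ≃* Multiplicative (ZMod 7) × Matrix.SpecialLinearGroup (Fin 2) (ZMod 3)) := by
  obtain ⟨e⟩ := hiso
  have : Fact (Nat.Prime 7) := ⟨by norm_num⟩
  have hNcard : Nat.card N = 24 := by
    rw [Nat.card_congr e.toEquiv, Nat.card_eq_fintype_card, card_specialLinearGroup_two_zmod_three]
  have hGcard : Nat.card G = 168 := by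
    rw [← N.card_mul_index, hNcard, hidx]
  have : Finite G := Nat.finite_of_card_ne_zero (by omega)
  obtain ⟨g, hg⟩ := exists_prime_orderOf_dvd_card' (G := G) 7 (by rw [hGcard]; norm_num)
  have hconj : MulAut.conjNormal (H := N) g = 1 := by
    have h := mulAut_specialLinearGroup_two_zmod_three_eq_one
      (MulAut.congr e (MulAut.conjNormal (H := N) g))
      (by rw [← map_pow, ← map_pow, ← hg, pow_orderOf_eq_one, map_one, map_one])
    exact (map_eq_one_iff _ (MulAut.congr e).injective).1 h
  have hcomm : ∀ n : N, Commute g n := fun n => by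
    have h := congrArg Subtype.val (DFunLike.congr_fun hconj n)
    rw [MulAut.conjNormal_apply, MulAut.one_apply] at h
    exact mul_inv_eq_iff_eq_mul.1 h
  let P : Subgroup G := Subgroup.zpowers g
  have hPcard : Nat.card P = 7 := by rw [Nat.card_zpowers, hg]
  have hdisj : Disjoint P N := Subgroup.disjoint_of_coprime_natCard (by
    rw [hPcard, hNcard]; norm_num)
  have hPN : ∀ (p : P) (n : N), Commute (P.subtype p) (N.subtype n) := by
    rintro ⟨_, k, rfl⟩ n
    exact (hcomm n).zpow_left k
  let f : P × N →* G := P.subtype.noncommCoprod N.subtype hPN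
  have hf : Function.Injective f :=
    (MonoidHom.noncommCoprod_injective _ _ hPN).2
      ⟨P.subtype_injective, N.subtype_injective, by simpa using hdisj⟩
  have hbij : Function.Bijective f := (Nat.bijective_iff_injective_and_card f).2
    ⟨hf, by rw [Nat.card_prod, hPcard, hNcard, hGcard]⟩
  exact ⟨(MulEquiv.ofBijective f hbij).symm.trans
    ((mulEquivOfPrimeCardEq hPcard (by simp)).prodCongr e)⟩
end
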